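/- arXiv:2111.15237 — 3 statements merged into one kernel-verified Lean document; each statement's English description precedes it below -/
import Mathlib

section
/- Let A be a unital finite-dimensional algebra over a perfect field F with char(F) ≠ 2 and char(F) ≠ 3. If a linear map T : A → A satisfies T(1) = 1 and T(x)³ − x³ ∈ [A,A] for every x ∈ A, then T is the sum of a Jordan endomorphism of A and a linear map from A whose image is contained in rad(A); that is, there exist a linear map J : A → A with J(x²) = J(x)² for all x ∈ A and a linear map N : A → A with N(A) ⊆ rad(A) such that T = J + N. -/
/-- The radical of a finite-dimensional algebra, realized as the intersection of all
maximal two-sided ideals. -/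
noncomputable def ringRad (A : Type*) [Ring A] : TwoSidedIdeal A :=
  sInf {M : TwoSidedIdeal A | IsCoatom M}

open scoped TensorProduct

/-- Existence of a separability idempotent `∑ xᵢ ⊗ yᵢ`. -/
def HasSeparabilityIdempotent (F B : Type*) [Field F] [Ring B] [Algebra F B] : Prop :=
  ∃ (ι : Type) (_ : Fintype ι) (x y : ι → B), ∑ i, x i * y i = 1 ∧
    ∀ a : B, ∑ i, (a * x i) ⊗ₜ[F] y i = ∑ i, x i ⊗ₜ[F] (y i * a)

theorem HasSeparabilityIdempotent.of_algEquiv {F B C : Type*} [Field F] [Ring B] [Algebra F B]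
    [Ring C] [Algebra F C] (e : B ≃ₐ[F] C) (hB : HasSeparabilityIdempotent F B) :
    HasSeparabilityIdempotent F C := by
  obtain ⟨ι, _, x, y, hxy, hcas⟩ := hB
  refine ⟨ι, ‹_›, fun i => e (x i), fun i => e (y i), ?_, fun a => ?_⟩
  · simp [← map_mul, ← map_sum, hxy]
  · have := congrArg (TensorProduct.map e.toLinearMap e.toLinearMap) (hcas (e.symm a))
    simpa [map_sum] using this

theorem hasSeparabilityIdempotent_pi_matrix (K : Type*) [Field K] {n : ℕ} (d : Fin n → ℕ)
    [∀ k, NeZero (d k)] :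
    HasSeparabilityIdempotent K (Π k, Matrix (Fin (d k)) (Fin (d k)) K) := by
  refine ⟨Σ k, Fin (d k), inferInstance,
    fun i => Pi.single i.1 (Matrix.single i.2 0 1),
    fun i => Pi.single i.1 (Matrix.single 0 i.2 1), ?_, fun a => ?_⟩
  · simp only [← Pi.single_mul, Matrix.single_mul_single_same, mul_one]
    rw [Fintype.sum_sigma]
    have : ∀ k, ∑ j : Fin (d k), (Pi.single k (Matrix.single j j (1 : K)) :
        Π k, Matrix (Fin (d k)) (Fin (d k)) K) = Pi.single k 1 := by
      intro k
      rw [← Matrix.sum_single_one]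
      exact (map_sum (LinearMap.single K (fun k => Matrix (Fin (d k)) (Fin (d k)) K) k) _ _).symm
    simp only [this]
    exact Finset.univ_sum_single 1
  · let X : (i : Σ k, Fin (d k)) → Π k, Matrix (Fin (d k)) (Fin (d k)) K :=
      fun i => Pi.single i.1 (Matrix.single i.2 0 1)
    let Y : (i : Σ k, Fin (d k)) → Π k, Matrix (Fin (d k)) (Fin (d k)) K :=
      fun i => Pi.single i.1 (Matrix.single 0 i.2 1)
    let L : (Π k, Matrix (Fin (d k)) (Fin (d k)) K) →ₗ[K] _ :=
      ∑ i : Σ k, Fin (d k), ((TensorProduct.mk K _ _).flip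
        (Y i)) ∘ₗ LinearMap.mulRight K (X i)
    let R : (Π k, Matrix (Fin (d k)) (Fin (d k)) K) →ₗ[K] _ :=
      ∑ i : Σ k, Fin (d k), (TensorProduct.mk K _ _
        (X i)) ∘ₗ LinearMap.mulLeft K (Y i)
    suffices L = R by
      have := LinearMap.congr_fun this a
      simpa [L, R, X, Y, LinearMap.sum_apply] using this
    have hsingle : ∀ {k l : Fin n}, k ≠ l → ∀ (M : Matrix (Fin (d k)) (Fin (d k)) K)
        (N : Matrix (Fin (d l)) (Fin (d l)) K),
        (Pi.single k M * Pi.single l N : Π k, Matrix (Fin (d k)) (Fin (d k)) K) = 0 := by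
      intro k l hkl M N
      rw [← Pi.single_mul_left, Pi.single_eq_of_ne hkl, mul_zero, Pi.single_zero]
    refine LinearMap.pi_ext' fun k => Matrix.ext_linearMap K fun p q => ?_
    ext
    simp only [L, R, X, Y, LinearMap.comp_apply, LinearMap.sum_apply, LinearMap.flip_apply,
      TensorProduct.mk_apply, LinearMap.mulRight_apply, LinearMap.mulLeft_apply,
      LinearMap.single_apply, Matrix.singleLinearMap_apply, Fintype.sum_sigma]
    rw [Finset.sum_eq_single k, Finset.sum_eq_single k, Finset.sum_eq_single q,
      Finset.sum_eq_single p]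
    · simp [← Pi.single_mul]
    · intro j _ hj
      simp [← Pi.single_mul, Matrix.single_mul_single_of_ne, hj]
    · simp
    · intro j _ hj
      simp [← Pi.single_mul, Matrix.single_mul_single_of_ne, hj.symm]
    · simp
    · intro l _ hl
      refine Finset.sum_eq_zero fun j _ => ?_
      rw [hsingle hl, TensorProduct.tmul_zero]
    · simp
    · intro l _ hl
      refine Finset.sum_eq_zero fun j _ => ?_
      rw [hsingle hl.symm, TensorProduct.zero_tmul]
    · simp

theorem HasSeparabilityIdempotent.of_baseChange {F B : Type*} (K : Type*) [Field F] [Field K]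
    [Algebra F K] [Ring B] [Algebra F B] (hB : HasSeparabilityIdempotent K (K ⊗[F] B)) :
    HasSeparabilityIdempotent F B := by
  obtain ⟨ι, _, x, y, hxy, hcas⟩ := hB
  obtain ⟨ρ, hρ⟩ := (Algebra.linearMap F K).exists_leftInverse_of_injective
    (LinearMap.ker_eq_bot.mpr (algebraMap F K).injective)
  have hρ1 : ρ 1 = 1 := by simpa using LinearMap.congr_fun hρ 1
  let r (M : Type _) [AddCommGroup M] [Module F M] : K ⊗[F] M →ₗ[F] M :=
    (TensorProduct.lid F M).toLinearMap ∘ₗ ρ.rTensor M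
  have hr : ∀ (M : Type _) [AddCommGroup M] [Module F M] (c : K) (m : M),
    r M (c ⊗ₜ m) = ρ c • m := fun M _ _ c m => by simp [r]
  let Φ : (K ⊗[F] B) ⊗[K] (K ⊗[F] B) →ₗ[F] B ⊗[F] B :=
    r (B ⊗[F] B) ∘ₗ ((TensorProduct.AlgebraTensorModule.distribBaseChange
      F K B B).symm.toLinearMap.restrictScalars F)
  have hΦ : ∀ (c c' : K) (b b' : B), Φ ((c ⊗ₜ b) ⊗ₜ (c' ⊗ₜ b')) = ρ (c * c') • (b ⊗ₜ[F] b') := by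
    intro c c' b b'
    simp [Φ, hr]
  have h1 : ∀ u v : K ⊗[F] B, LinearMap.mul' F B (Φ (u ⊗ₜ v)) = r B (u * v) := by
    intro u v
    induction u with
    | zero => simp
    | add u u' hu hu' => simp only [TensorProduct.add_tmul, map_add, hu, hu', add_mul]
    | tmul c b =>
      induction v with
      | zero => simp
      | add u u' hu hu' => simp only [TensorProduct.tmul_add, map_add, hu, hu', mul_add]
      | tmul c' b' => simp [hΦ, hr]
  have h2 : ∀ (a : B) (u v : K ⊗[F] B), (LinearMap.mulLeft F a).rTensor B (Φ (u ⊗ₜ v)) =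
      Φ (((1 ⊗ₜ a) * u) ⊗ₜ v) := by
    intro a u v
    induction u with
    | zero => simp
    | add u u' hu hu' => simp only [TensorProduct.add_tmul, map_add, hu, hu', mul_add]
    | tmul c b =>
      induction v with
      | zero => simp
      | add u u' hu hu' => simp only [TensorProduct.tmul_add, map_add, hu, hu']
      | tmul c' b' => simp [hΦ]
  have h3 : ∀ (a : B) (u v : K ⊗[F] B), (LinearMap.mulRight F a).lTensor B (Φ (u ⊗ₜ v)) =
      Φ (u ⊗ₜ (v * (1 ⊗ₜ a))) := by
    intro a u v
    induction u with
    | zero => simp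
    | add u u' hu hu' => simp only [TensorProduct.add_tmul, map_add, hu, hu']
    | tmul c b =>
      induction v with
      | zero => simp
      | add u u' hu hu' => simp only [TensorProduct.tmul_add, map_add, hu, hu', add_mul]
      | tmul c' b' => simp [hΦ]
  obtain ⟨k, z, w, hzw⟩ := TensorProduct.exists_sum_tmul_eq (Φ (∑ i, x i ⊗ₜ[K] y i))
  refine ⟨Fin k, inferInstance, z, w, ?_, fun a => ?_⟩
  · have := congrArg (LinearMap.mul' F B) hzw
    simp only [map_sum, h1, LinearMap.mul'_apply] at this
    rw [← this, ← map_sum, hxy, Algebra.TensorProduct.one_def, hr, hρ1, one_smul]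
  · have e1 := congrArg ((LinearMap.mulLeft F a).rTensor B) hzw
    have e2 := congrArg ((LinearMap.mulRight F a).lTensor B) hzw
    have := congrArg Φ (hcas (1 ⊗ₜ a))
    simp only [map_sum, h2, h3, LinearMap.rTensor_tmul, LinearMap.lTensor_tmul,
      LinearMap.mulLeft_apply, LinearMap.mulRight_apply] at e1 e2 this
    rw [← e1, ← e2, this]

theorem exists_section_mul_sub_mem_pow {F A B : Type*} [Field F] [Ring A] [Algebra F A]
    [Ring B] [Algebra F B] (hB : HasSeparabilityIdempotent F B) (p : A →ₐ[F] B)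
    (hp : Function.Surjective p) (m : ℕ) :
    ∃ s : B →ₗ[F] A, (∀ b, p (s b) = b) ∧
      ∀ a b, s a * s b - s (a * b) ∈ LinearMap.ker p.toLinearMap ^ (m + 1) := by
  set K := LinearMap.ker p.toLinearMap with hK
  have memK : ∀ a, a ∈ K ↔ p a = 0 := fun a => by simp [hK]
  induction m with
  | zero =>
    obtain ⟨s, hs⟩ := p.toLinearMap.exists_rightInverse_of_surjective
      (LinearMap.range_eq_top.mpr hp)
    have hs' : ∀ b, p (s b) = b := fun b => by simpa using LinearMap.congr_fun hs b
    exact ⟨s, hs', fun a b => by simp [memK, hs']⟩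
  | succ m ih =>
    obtain ⟨s, hs, hmul⟩ := ih
    obtain ⟨ι, _, x, y, hxy, hcas⟩ := hB
    have hle : K ^ (m + 1) ≤ K := by
      rw [pow_succ]
      refine Submodule.mul_le.mpr fun a _ b hb => ?_
      rw [memK] at hb ⊢
      simp [hb]
    have hleft : ∀ a k, k ∈ K ^ (m + 1) → a * k ∈ K ^ (m + 1) := by
      intro a k hk
      have h1 : (⊤ : Submodule F A) * K ≤ K := by
        refine Submodule.mul_le.mpr fun a _ b hb => ?_
        rw [memK] at hb ⊢
        simp [hb]
      have h2 : (⊤ : Submodule F A) * K ^ (m + 1) ≤ K ^ (m + 1) := by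
        rw [pow_succ', ← mul_assoc]
        exact mul_le_mul_left h1 _
      exact h2 (Submodule.mul_mem_mul Submodule.mem_top hk)
    have hmm : ∀ u v, u ∈ K → v ∈ K ^ (m + 1) → u * v ∈ K ^ (m + 1 + 1) := by
      intro u v hu hv
      rw [pow_succ' K (m + 1)]
      exact Submodule.mul_mem_mul hu hv
    let f : B →ₗ[F] B →ₗ[F] A :=
      (LinearMap.mul F A).compl₁₂ s s - (LinearMap.mul F B).compr₂ s
    have hf : ∀ a b, f a b = s a * s b - s (a * b) := fun a b => by simp [f]
    have hfK : ∀ a b, f a b ∈ K ^ (m + 1) := fun a b => by rw [hf]; exact hmul a b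
    let h : B →ₗ[F] A := ∑ i, (LinearMap.mulLeft F (s (x i))) ∘ₗ f (y i)
    have hh : ∀ b, h b = ∑ i, s (x i) * f (y i) b := fun b => by
      simp [h, LinearMap.sum_apply]
    have hhK : ∀ b, h b ∈ K ^ (m + 1) := fun b => by
      rw [hh]
      exact Submodule.sum_mem _ fun i _ => hleft _ _ (hfK _ _)
    have hswap : ∀ a b, ∑ i, s (a * x i) * f (y i) b = ∑ i, s (x i) * f (y i * a) b := by
      intro a b
      have := congrArg (LinearMap.mul' F A ∘ₗ TensorProduct.map s (f.flip b)) (hcas a)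
      simpa [map_sum] using this
    have hcoc : ∀ a b c, f a b * s c = s a * f b c - f (a * b) c + f a (b * c) := by
      intro a b c
      simp only [hf, mul_assoc]
      noncomm_ring
    have e1 : ∀ a b, s a * h b =
        ∑ i, s (x i) * f (y i * a) b + ∑ i, f a (x i) * f (y i) b := by
      intro a b
      rw [← hswap, hh, Finset.mul_sum, ← Finset.sum_add_distrib]
      refine Finset.sum_congr rfl fun i _ => ?_
      rw [hf a]
      noncomm_ring
    have e2 : ∀ a b, h a * s b = (s 1 + ∑ i, f (x i) (y i)) * f a b
        - ∑ i, s (x i) * f (y i * a) b + h (a * b) := by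
      intro a b
      have : s 1 + ∑ i, f (x i) (y i) = ∑ i, s (x i) * s (y i) := by
        rw [← hxy, map_sum, ← Finset.sum_add_distrib]
        exact Finset.sum_congr rfl fun i _ => by rw [hf]; abel
      rw [this, hh, hh, Finset.sum_mul, Finset.sum_mul, ← Finset.sum_sub_distrib,
        ← Finset.sum_add_distrib]
      refine Finset.sum_congr rfl fun i _ => ?_
      rw [mul_assoc, hcoc]
      noncomm_ring
    refine ⟨s - h, fun b => ?_, fun a b => ?_⟩
    · have := (memK _).1 (hle (hhK b))
      simp [hs, this]
    · have key : (s - h) a * (s - h) b - (s - h) (a * b) =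
          (1 - s 1) * f a b - ∑ i, f a (x i) * f (y i) b
            - (∑ i, f (x i) (y i)) * f a b + h a * h b := by
        have : (s - h) a * (s - h) b - (s - h) (a * b) =
          f a b - s a * h b - h a * s b + h a * h b + h (a * b) := by
          simp only [LinearMap.sub_apply, hf]
          noncomm_ring
        rw [this, e1, e2]
        noncomm_ring
      rw [key]
      refine add_mem (sub_mem (sub_mem (hmm _ _ ?_ (hfK _ _)) ?_) (hmm _ _ ?_ (hfK _ _)))
        (hmm _ _ (hle (hhK _)) (hhK _))
      · simp [memK, hs]
      · exact Submodule.sum_mem _ fun i _ => hmm _ _ (hle (hfK _ _)) (hfK _ _)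
      · exact Submodule.sum_mem _ fun i _ => hle (hfK _ _)

theorem mem_ringJacobson_of_forall_isNilpotent {R : Type*} [Ring R] {x : R}
    (hx : ∀ y, IsNilpotent (y * x)) : x ∈ Ring.jacobson R := by
  rw [← Ideal.jacobson_bot, Ideal.mem_jacobson_iff]
  intro y
  obtain ⟨u, hu⟩ := (hx y).isUnit_one_add
  refine ⟨↑u⁻¹, ?_⟩
  have : (↑u⁻¹ : R) * (1 + y * x) = 1 := by rw [← hu]; simp
  rw [Ideal.mem_bot, ← this]
  noncomm_ring

theorem isNilpotent_of_mem_ringJacobson {R : Type*} [Ring R] [IsArtinianRing R] {x : R}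
    (hx : x ∈ Ring.jacobson R) : IsNilpotent x := by
  obtain ⟨n, hn⟩ := IsArtinianRing.isNilpotent_jacobson_bot (R := R)
  rw [Ideal.jacobson_bot] at hn
  refine ⟨n, ?_⟩
  have := Ideal.pow_mem_pow hx n
  rwa [hn] at this

/-- Elements of the radical of a base change that come from the algebra lie in its radical. -/
theorem mem_ringJacobson_of_one_tmul_mem {F B : Type*} (K : Type*) [Field F] [Field K]
    [Algebra F K] [Ring B] [Algebra F B] [FiniteDimensional F B] {b : B}
    (hb : (1 : K) ⊗ₜ[F] b ∈ Ring.jacobson (K ⊗[F] B)) : b ∈ Ring.jacobson B := by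
  have : IsArtinianRing (K ⊗[F] B) := IsArtinianRing.of_finite K _
  refine mem_ringJacobson_of_forall_isNilpotent fun y => ?_
  have h1 : (1 : K) ⊗ₜ[F] (y * b) ∈ Ring.jacobson (K ⊗[F] B) := by
    simpa using Ideal.mul_mem_left _ ((1 : K) ⊗ₜ[F] y) hb
  have h2 := isNilpotent_of_mem_ringJacobson h1
  have hinj : Function.Injective (Algebra.TensorProduct.includeRight : B →ₐ[F] K ⊗[F] B) :=
    Algebra.TensorProduct.includeRight_injective (algebraMap F K).injective
  exact (IsNilpotent.map_iff hinj).1 h2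

/-- A nonzero Galois-stable subspace of a base change contains a nonzero rational vector. -/
theorem exists_one_tmul_mem_of_galois_stable {F K V : Type*} [Field F] [Field K] [Algebra F K]
    [IsGalois F K] [AddCommGroup V] [Module F V] [FiniteDimensional F V]
    (W : Submodule K (K ⊗[F] V)) (hW : W ≠ ⊥)
    (hstab : ∀ (g : K ≃ₐ[F] K), ∀ w ∈ W, g.toLinearMap.rTensor V w ∈ W) :
    ∃ v : V, v ≠ 0 ∧ (1 : K) ⊗ₜ[F] v ∈ W := by
  classical
  let b := Module.finBasis F V
  let c := Algebra.TensorProduct.basis K b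
  have hc : ∀ (g : K ≃ₐ[F] K) w i, c.repr (g.toLinearMap.rTensor V w) i = g (c.repr w i) := by
    intro g w i
    induction w with
    | zero => simp
    | add u v hu hv => simp [hu, hv]
    | tmul a v => simp [c, Algebra.TensorProduct.basis_repr_tmul]
  have hex : ∃ n, ∃ w ∈ W, w ≠ 0 ∧ (c.repr w).support.card = n := by
    obtain ⟨w, hw, h0⟩ := W.ne_bot_iff.1 hW
    exact ⟨_, w, hw, h0, rfl⟩
  obtain ⟨w, hw, hw0, hcard⟩ := Nat.find_spec hex
  have hmin : ∀ u ∈ W, (c.repr u).support.card < (c.repr w).support.card → u = 0 := by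
    intro u hu hlt
    by_contra h0
    exact Nat.find_min hex (hcard ▸ hlt) ⟨u, hu, h0, rfl⟩
  obtain ⟨i, hi⟩ : ∃ i, c.repr w i ≠ 0 := by
    by_contra! h
    exact hw0 (c.repr.map_eq_zero_iff.1 (Finsupp.ext h))
  set u := (c.repr w i)⁻¹ • w with hu
  have huW : u ∈ W := W.smul_mem _ hw
  have hui : c.repr u i = 1 := by simp [hu, hi]
  have husupp : (c.repr u).support ⊆ (c.repr w).support := by
    rw [hu, map_smul]; exact Finsupp.support_smul
  have hfix : ∀ g : K ≃ₐ[F] K, g.toLinearMap.rTensor V u = u := by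
    intro g
    rw [← sub_eq_zero]
    refine hmin _ (W.sub_mem (hstab g u huW) huW) (Finset.card_lt_card ?_)
    refine (Finset.ssubset_iff_of_subset ?_).2 ⟨i, by simpa using hi, by simp [hc, hui]⟩
    intro j hj
    refine husupp ?_
    rw [Finsupp.mem_support_iff] at hj ⊢
    intro h0
    apply hj
    simp [hc, h0]
  have hrat : ∀ j, ∃ a : F, algebraMap F K a = c.repr u j := by
    intro j
    refine (InfiniteGalois.mem_range_algebraMap_iff_fixed _).2 fun g => ?_
    rw [← hc, hfix]
  choose a ha using hrat
  have heq : (1 : K) ⊗ₜ[F] (∑ j, a j • b j) = u := by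
    rw [← c.sum_repr u, TensorProduct.tmul_sum]
    refine Finset.sum_congr rfl fun j _ => ?_
    rw [← ha, TensorProduct.tmul_smul, algebraMap_smul, Algebra.TensorProduct.basis_apply]
  refine ⟨_, ?_, heq ▸ huW⟩
  intro h0
  rw [h0, TensorProduct.tmul_zero] at heq
  rw [← heq] at hui
  simp at hui

theorem ringJacobson_baseChange_eq_bot {F B : Type*} (K : Type*) [Field F] [Field K]
    [Algebra F K] [IsGalois F K] [Ring B] [Algebra F B] [FiniteDimensional F B]
    (hB : Ring.jacobson B = ⊥) : Ring.jacobson (K ⊗[F] B) = ⊥ := by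
  by_contra h
  obtain ⟨v, hv, hvW⟩ := exists_one_tmul_mem_of_galois_stable (F := F) (K := K) (V := B)
    ((Ring.jacobson (K ⊗[F] B)).restrictScalars K) (by simpa using h) (by
      intro g w hw
      let e : K ⊗[F] B ≃ₐ[F] K ⊗[F] B := Algebra.TensorProduct.congr g AlgEquiv.refl
      have : RingHomSurjective e.toRingEquiv.toRingHom := ⟨e.surjective⟩
      exact Ring.le_comap_jacobson e.toRingEquiv.toRingHom hw)
  have := mem_ringJacobson_of_one_tmul_mem K (b := v) hvW
  rw [hB] at this
  exact hv this

/-- The semisimple quotient of a finite-dimensional algebra over an algebraically closed field is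
a product of matrix algebras. -/
theorem exists_algHom_pi_matrix_of_isAlgClosed (K C : Type*) [Field K] [IsAlgClosed K] [Ring C]
    [Algebra K C] [FiniteDimensional K C] :
    ∃ (n : ℕ) (d : Fin n → ℕ) (φ : C →ₐ[K] Π k, Matrix (Fin (d k)) (Fin (d k)) K),
      Function.Surjective φ ∧ ∀ c, φ c = 0 → c ∈ Ring.jacobson C := by
  have : IsArtinianRing C := IsArtinianRing.of_finite K _
  have : IsSemisimpleRing (C ⧸ Ring.jacobson C) :=
    IsArtinianRing.isSemisimpleRing_iff_jacobson.mpr (Ring.jacobson_quotient_jacobson C)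
  have : FiniteDimensional K (C ⧸ Ring.jacobson C) :=
    Module.Finite.of_surjective (Ideal.Quotient.mkₐ K (Ring.jacobson C)).toLinearMap
      (Ideal.Quotient.mkₐ_surjective K _)
  obtain ⟨n, d, -, ⟨e⟩⟩ :=
    IsSemisimpleRing.exists_algEquiv_pi_matrix_of_isAlgClosed K (C ⧸ Ring.jacobson C)
  refine ⟨n, d, e.toAlgHom.comp (Ideal.Quotient.mkₐ K (Ring.jacobson C)),
    e.surjective.comp (Ideal.Quotient.mkₐ_surjective K _), fun c hc => ?_⟩
  have : Ideal.Quotient.mk (Ring.jacobson C) c = 0 := by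
    simpa using hc
  exact Ideal.Quotient.eq_zero_iff_mem.1 this

/-- Every finite-dimensional algebra has a vector-valued trace whose trace form has kernel the
Jacobson radical. -/
theorem exists_trace_map (F A : Type*) [Field F] [Ring A] [Algebra F A]
    [FiniteDimensional F A] :
    ∃ (n : ℕ) (t : A →ₗ[F] (Fin n → AlgebraicClosure F)), (∀ x y, t (x * y) = t (y * x)) ∧
      (∀ a ∈ Ring.jacobson A, t a = 0) ∧
      ∀ a, (∀ y, t (a * y) = 0) → a ∈ Ring.jacobson A := by
  let K := AlgebraicClosure F
  obtain ⟨n, d, φ, hφ, hker⟩ := exists_algHom_pi_matrix_of_isAlgClosed K (K ⊗[F] A)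
  have : IsArtinianRing A := IsArtinianRing.of_finite F _
  let τ : K ⊗[F] A →ₗ[K] (Fin n → K) := LinearMap.pi fun k =>
    Matrix.traceLinearMap (Fin (d k)) K K ∘ₗ LinearMap.proj k ∘ₗ φ.toLinearMap
  have hτ : ∀ c k, τ c k = (φ c k).trace := fun c k => rfl
  let t : A →ₗ[F] (Fin n → K) := τ.restrictScalars F ∘ₗ
    (Algebra.TensorProduct.includeRight : A →ₐ[F] K ⊗[F] A).toLinearMap
  have ht : ∀ a, t a = τ (1 ⊗ₜ a) := fun a => rfl
  refine ⟨n, t, fun x y => ?_, fun a ha => ?_, fun a ha => ?_⟩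
  · have h1 : ∀ x y : A, (1 : K) ⊗ₜ[F] (x * y) = (1 ⊗ₜ x) * (1 ⊗ₜ y) := by simp
    funext k
    rw [ht, ht, hτ, hτ, h1, h1, map_mul, map_mul, Pi.mul_apply, Pi.mul_apply, Matrix.trace_mul_comm]
  · funext k
    rw [ht, hτ]
    have h1 : IsNilpotent (φ ((1 : K) ⊗ₜ[F] a) k) :=
      (((isNilpotent_of_mem_ringJacobson ha).map
        (Algebra.TensorProduct.includeRight : A →ₐ[F] K ⊗[F] A)).map φ).map
          (Pi.evalRingHom (fun k => Matrix (Fin (d k)) (Fin (d k)) K) k)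
    exact (Matrix.isNilpotent_trace_of_isNilpotent h1).eq_zero
  · refine mem_ringJacobson_of_one_tmul_mem K (hker _ ?_)
    have h1 : ∀ c : K ⊗[F] A, τ ((1 ⊗ₜ a) * c) = 0 := by
      intro c
      induction c with
      | zero => simp
      | add u v hu hv => rw [mul_add, map_add, hu, hv, add_zero]
      | tmul s y =>
        have : ((1 : K) ⊗ₜ[F] a) * (s ⊗ₜ y) = s • ((1 : K) ⊗ₜ[F] (a * y)) := by
          simp [TensorProduct.smul_tmul']
        rw [this, map_smul, ← ht, ha, smul_zero]
    funext k
    refine (Matrix.ext_iff_trace_mul_right).2 fun M => ?_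
    obtain ⟨c, hc⟩ := hφ (Pi.single k M)
    have := congrFun (h1 c) k
    rw [hτ, map_mul, hc] at this
    simpa using this

theorem hasSeparabilityIdempotent_of_ringJacobson_eq_bot (F B : Type*) [Field F] [PerfectField F]
    [Ring B] [Algebra F B] [FiniteDimensional F B] (hB : Ring.jacobson B = ⊥) :
    HasSeparabilityIdempotent F B := by
  let K := AlgebraicClosure F
  have : IsArtinianRing (K ⊗[F] B) := IsArtinianRing.of_finite K _
  have : IsSemisimpleRing (K ⊗[F] B) :=
    IsArtinianRing.isSemisimpleRing_iff_jacobson.mpr (ringJacobson_baseChange_eq_bot K hB)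
  obtain ⟨n, d, hd, ⟨e⟩⟩ :=
    IsSemisimpleRing.exists_algEquiv_pi_matrix_of_isAlgClosed K (K ⊗[F] B)
  exact ((hasSeparabilityIdempotent_pi_matrix K d).of_algEquiv e.symm).of_baseChange K

/-- The **Wedderburn principal theorem**: over a perfect field the quotient of a
finite-dimensional algebra by its radical lifts multiplicatively. -/
theorem exists_multiplicative_section_of_ringJacobson (F A : Type*) [Field F] [PerfectField F]
    [Ring A] [Algebra F A] [FiniteDimensional F A] :
    ∃ s : (A ⧸ Ring.jacobson A) →ₗ[F] A,
      (∀ b, Ideal.Quotient.mkₐ F (Ring.jacobson A) (s b) = b) ∧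
        ∀ a b, s (a * b) = s a * s b := by
  have : IsArtinianRing A := IsArtinianRing.of_finite F _
  have hsurj := Ideal.Quotient.mkₐ_surjective F (Ring.jacobson A)
  have : FiniteDimensional F (A ⧸ Ring.jacobson A) :=
    Module.Finite.of_surjective (Ideal.Quotient.mkₐ F (Ring.jacobson A)).toLinearMap hsurj
  obtain ⟨n, hn⟩ := IsArtinianRing.isNilpotent_jacobson_bot (R := A)
  rw [Ideal.jacobson_bot] at hn
  obtain ⟨s, hs, hmul⟩ := exists_section_mul_sub_mem_pow
    (hasSeparabilityIdempotent_of_ringJacobson_eq_bot F _ (Ring.jacobson_quotient_jacobson A))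
    _ hsurj n
  refine ⟨s, hs, fun a b => ?_⟩
  set K := LinearMap.ker (Ideal.Quotient.mkₐ F (Ring.jacobson A)).toLinearMap
  have hle : ∀ m : ℕ, ∀ x ∈ K ^ (m + 1), x ∈ Ring.jacobson A ^ (m + 1) := by
    have hK : ∀ x ∈ K, x ∈ Ring.jacobson A := fun x hx =>
      Ideal.Quotient.eq_zero_iff_mem.1 hx
    intro m
    induction m with
    | zero => simpa [Submodule.pow_one] using hK
    | succ m ih =>
      intro x hx
      rw [pow_succ'] at hx
      rw [Ideal.IsTwoSided.pow_succ]
      induction hx using Submodule.mul_induction_on' with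
      | mem_mul_mem u hu v hv => exact Ideal.mul_mem_mul (hK u hu) (ih v hv)
      | add u _ v _ hu hv => exact add_mem hu hv
  have h0 := hle n _ (hmul a b)
  rw [Ideal.IsTwoSided.pow_succ, hn, mul_zero] at h0
  exact (sub_eq_zero.1 h0).symm

/-- Every maximal two-sided ideal contains the Jacobson radical. -/
theorem mem_ringRad_of_mem_ringJacobson (A : Type*) [Ring A] {a : A} (ha : a ∈ Ring.jacobson A) :
    a ∈ ringRad A := by
  rw [ringRad, TwoSidedIdeal.mem_sInf]
  intro M hM
  by_contra haM
  have hlt : M < M ⊔ (Ring.jacobson A).toTwoSided :=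
    lt_of_le_of_ne le_sup_left fun h =>
      haM (h ▸ TwoSidedIdeal.mem_sup_right (Ideal.mem_toTwoSided.2 ha))
  have h1 : (1 : A) ∈ M ⊔ (Ring.jacobson A).toTwoSided := by
    rw [hM.2 _ hlt]
    trivial
  obtain ⟨x, hx, y, hy, hxy⟩ := TwoSidedIdeal.mem_sup.1 h1
  have hne : TwoSidedIdeal.asIdeal M ≠ ⊤ := fun h =>
    hM.1 ((TwoSidedIdeal.one_mem_iff M).1
      (TwoSidedIdeal.mem_asIdeal.1 (h ▸ Submodule.mem_top)))
  obtain ⟨m, hm, hle⟩ := Ideal.exists_le_maximal _ hne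
  refine hm.ne_top ((Ideal.eq_top_iff_one m).2 (hxy ▸ m.add_mem (hle hx) ?_))
  exact Ring.jacobson_le_of_isMaximal m (Ideal.mem_toTwoSided.1 hy)

/-- A trace that is preserved on cubes by a unital linear map is preserved on products `x * y`
and `x ^ 2 * y`. -/
theorem trace_identities_of_cube {F A V : Type*} [Field F] [Ring A] [Algebra F A]
    [AddCommGroup V] [Module F V] (h2 : (2 : F) ≠ 0) (h3 : (3 : F) ≠ 0) (T : A →ₗ[F] A)
    (hT1 : T 1 = 1) (t : A →ₗ[F] V) (ht : ∀ x y, t (x * y) = t (y * x))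
    (hT : ∀ x, t (T x ^ 3) = t (x ^ 3)) :
    (∀ x y, t (T x * T y) = t (x * y)) ∧ ∀ x y, t (T x ^ 2 * T y) = t (x ^ 2 * y) := by
  have h6 : (6 : F) ≠ 0 := by
    rw [show (6 : F) = 2 * 3 by norm_num]; exact mul_ne_zero h2 h3
  have expand3 : ∀ x y, t ((y + x) ^ 3) + t ((y - x) ^ 3) - (2 : F) • t (y ^ 3) =
      (6 : F) • t (x ^ 2 * y) := by
    intro x y
    have e : (y + x) ^ 3 + (y - x) ^ 3 - (2 : F) • y ^ 3 =
        (2 : F) • (x ^ 2 * y + y * x ^ 2 + x * y * x) := by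
      simp only [two_smul]
      noncomm_ring
    rw [← map_smul, ← map_add, ← map_sub, e, map_smul, map_add, map_add, ht y, ht (x * y) x,
      ← mul_assoc, ← pow_two, show (6 : F) = 2 * 3 by norm_num, mul_smul]
    congr 1
    rw [show (3 : F) = 1 + 1 + 1 by norm_num, add_smul, add_smul, one_smul]
  have hcube : ∀ x y, t (T x ^ 2 * T y) = t (x ^ 2 * y) := by
    intro x y
    refine smul_right_injective V h6 ?_
    simp only [← expand3]
    rw [← map_add T, ← map_sub T, hT, hT, hT]
  refine ⟨fun x y => ?_, hcube⟩
  have hsq : ∀ x, t (T x ^ 2) = t (x ^ 2) := fun x => by simpa [hT1] using hcube x 1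
  have expand2 : ∀ x y, t ((x + y) ^ 2) - t (x ^ 2) - t (y ^ 2) = (2 : F) • t (x * y) := by
    intro x y
    have e : (x + y) ^ 2 - x ^ 2 - y ^ 2 = x * y + y * x := by noncomm_ring
    rw [← map_sub, ← map_sub, e, map_add, ht y x, two_smul]
  refine smul_right_injective V h2 ?_
  simp only [← expand2]
  rw [← map_add T, hsq, hsq, hsq]

/-- **Corollary 3.8.** Let `A` be a unital finite-dimensional algebra over a perfect field
`F` with `char F ≠ 2, 3`. If a linear map `T : A → A` satisfies `T 1 = 1` and
`T x ^ 3 - x ^ 3 ∈ [A,A]` for every `x ∈ A`, then `T` is the sum of a Jordan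
endomorphism of `A` and a linear map from `A` to `rad A`. -/
theorem sum_jordan_endomorphism_radical_map (F A : Type*) [Field F] [PerfectField F]
    [Ring A] [Algebra F A] [FiniteDimensional F A]
    (h2 : (2 : F) ≠ 0) (h3 : (3 : F) ≠ 0) (T : A →ₗ[F] A) (hT1 : T 1 = 1)
    (hT : ∀ x : A, T x ^ 3 - x ^ 3 ∈
      Submodule.span F {z : A | ∃ u v : A, z = u * v - v * u}) :
    ∃ (J N : A →ₗ[F] A), (∀ x : A, J (x ^ 2) = J x ^ 2) ∧
      (∀ x : A, N x ∈ ringRad A) ∧ T = J + N := by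
  obtain ⟨n, t, ht, htJ, htnd⟩ := exists_trace_map F A
  obtain ⟨s, hs, hsmul⟩ := exists_multiplicative_section_of_ringJacobson F A
  have htT : ∀ x, t (T x ^ 3) = t (x ^ 3) := by
    intro x
    have hle : Submodule.span F {z : A | ∃ u v : A, z = u * v - v * u} ≤ LinearMap.ker t := by
      rw [Submodule.span_le]
      rintro _ ⟨u, v, rfl⟩
      simp [ht u v]
    have := hle (hT x)
    rwa [LinearMap.mem_ker, map_sub, sub_eq_zero] at this
  obtain ⟨hprod, hcube⟩ := trace_identities_of_cube h2 h3 T hT1 t ht htT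
  set p := Ideal.Quotient.mkₐ F (Ring.jacobson A)
  have hp0 : ∀ a, p a = 0 ↔ a ∈ Ring.jacobson A := fun a => Ideal.Quotient.eq_zero_iff_mem
  have hpsurj : Function.Surjective p := Ideal.Quotient.mkₐ_surjective F _
  have hker : LinearMap.ker (p.toLinearMap ∘ₗ T) ≤ LinearMap.ker p.toLinearMap := by
    intro x hx
    have hx' : T x ∈ Ring.jacobson A := (hp0 _).1 hx
    refine (hp0 _).2 (htnd x fun y => ?_)
    rw [← hprod]
    exact htJ _ (Ideal.mul_mem_right _ _ hx')
  have hTsurj : Function.Surjective (p.toLinearMap ∘ₗ T) := by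
    have : FiniteDimensional F (A ⧸ Ring.jacobson A) :=
      Module.Finite.of_surjective p.toLinearMap hpsurj
    rw [← LinearMap.range_eq_top]
    refine Submodule.eq_top_of_finrank_eq (le_antisymm (Submodule.finrank_le _) ?_)
    have e1 := LinearMap.finrank_range_add_finrank_ker (p.toLinearMap ∘ₗ T)
    have e2 := LinearMap.finrank_range_add_finrank_ker p.toLinearMap
    have e3 := Submodule.finrank_mono hker
    rw [LinearMap.range_eq_top.2 (show Function.Surjective p.toLinearMap from hpsurj),
      finrank_top] at e2
    omega
  have hjordan : ∀ x, p (T (x ^ 2)) = p (T x) ^ 2 := by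
    intro x
    rw [← map_pow, ← sub_eq_zero, ← map_sub, hp0]
    refine htnd _ fun z => ?_
    obtain ⟨y, hy⟩ := hTsurj (p z)
    have hzy : z - T y ∈ Ring.jacobson A := by
      rw [← hp0, map_sub, sub_eq_zero]
      exact hy.symm
    have h0 : t ((T (x ^ 2) - T x ^ 2) * T y) = 0 := by
      rw [sub_mul, map_sub, hprod, hcube, sub_self]
    rw [← sub_add_cancel z (T y), mul_add, map_add, h0, add_zero]
    exact htJ _ (Ideal.mul_mem_left _ _ hzy)
  refine ⟨s ∘ₗ p.toLinearMap ∘ₗ T, T - s ∘ₗ p.toLinearMap ∘ₗ T, fun x => ?_, fun x => ?_, by simp⟩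
  · simp only [LinearMap.comp_apply, AlgHom.toLinearMap_apply, hjordan]
    rw [pow_two, pow_two, hsmul]
  · refine mem_ringRad_of_mem_ringJacobson A ((hp0 _).1 ?_)
    simp [hs]
end

section
/- Let A be a finite-dimensional semisimple algebra over a field F with char(F) ≠ 2 and char(F) ≠ 3. If T : A → A is a linear map such that for every x ∈ A there exists an invertible a_x ∈ A with T(x) = a_x x a_x⁻¹ (a local inner automorphism), then T is a Jordan automorphism of A and belongs to the multiplication algebra M(A), i.e., there exist finitely many aᵢ, bᵢ ∈ A with T(x) = Σᵢ aᵢ x bᵢ for all x ∈ A. -/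
open scoped TensorProduct

attribute [local instance] TensorProduct.Algebra.module

/-- A nonzero finite-dimensional algebra over an algebraically closed field carries a nonzero
trace functional. -/
theorem exists_ne_zero_trace_of_isAlgClosed (K B : Type*) [Field K] [IsAlgClosed K] [Ring B]
    [Algebra K B] [FiniteDimensional K B] [Nontrivial B] :
    ∃ t : B →ₗ[K] K, (∀ x y, t (x * y) = t (y * x)) ∧ t ≠ 0 := by
  have : IsArtinianRing B := .of_finite K B
  have : IsSemisimpleRing (B ⧸ Ring.jacobson B) := IsSemiprimaryRing.isSemisimpleRing
  have : Nontrivial (B ⧸ Ring.jacobson B) :=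
    Ideal.Quotient.nontrivial_iff.mpr (Ring.jacobson_lt_top B).ne
  obtain ⟨n, d, hd, ⟨e⟩⟩ :=
    IsSemisimpleRing.exists_algEquiv_pi_matrix_of_isAlgClosed K (B ⧸ Ring.jacobson B)
  obtain ⟨i⟩ : Nonempty (Fin n) := by
    by_contra h
    rw [not_nonempty_iff] at h
    have := e.symm.surjective.subsingleton
    exact not_subsingleton _ this
  have := hd i
  let φ : B →ₐ[K] Matrix (Fin (d i)) (Fin (d i)) K :=
    (Pi.evalAlgHom K _ i).comp (e.toAlgHom.comp (Ideal.Quotient.mkₐ K (Ring.jacobson B)))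
  have hφ : Function.Surjective φ := by
    intro m
    obtain ⟨x, hx⟩ := Ideal.Quotient.mkₐ_surjective K (Ring.jacobson B) (e.symm (Pi.single i m))
    refine ⟨x, ?_⟩
    change e (Ideal.Quotient.mkₐ K (Ring.jacobson B) x) i = m
    rw [hx]
    simp
  refine ⟨(Matrix.traceLinearMap (Fin (d i)) K K).comp φ.toLinearMap, fun x y ↦ ?_, fun h ↦ ?_⟩
  · simpa using Matrix.trace_mul_comm (φ x) (φ y)
  · obtain ⟨x, hx⟩ := hφ (Matrix.single 0 0 1)
    have := LinearMap.congr_fun h x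
    simp [hx] at this

/-- A nonzero finite-dimensional algebra over a field carries a nonzero trace functional. -/
theorem exists_ne_zero_trace (F D : Type*) [Field F] [Ring D]
    [Algebra F D] [FiniteDimensional F D] [Nontrivial D] :
    ∃ t : D →ₗ[F] F, (∀ x y, t (x * y) = t (y * x)) ∧ t ≠ 0 := by
  let K := AlgebraicClosure F
  obtain ⟨t, ht, ht0⟩ := exists_ne_zero_trace_of_isAlgClosed K (K ⊗[F] D)
  obtain ⟨c, hc⟩ : ∃ c : D, t (1 ⊗ₜ c) ≠ 0 := by
    by_contra! h
    refine ht0 (LinearMap.ext fun z ↦ ?_)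
    induction z with
    | zero => simp
    | add x y hx hy => simp [hx, hy]
    | tmul k d => simpa [TensorProduct.smul_tmul', h] using t.map_smul k (1 ⊗ₜ d)
  obtain ⟨g, hg⟩ : ∃ g : Module.Dual F K, g (t (1 ⊗ₜ c)) ≠ 0 := by
    by_contra! h
    exact hc ((Module.forall_dual_apply_eq_zero_iff F _).mp h)
  refine ⟨g ∘ₗ t.restrictScalars F ∘ₗ
    (Algebra.TensorProduct.includeRight : D →ₐ[F] K ⊗[F] D).toLinearMap, fun x y ↦ ?_, fun h ↦ ?_⟩
  · simpa using congrArg g (ht (1 ⊗ₜ x) (1 ⊗ₜ y))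
  · exact hg (by simpa using LinearMap.congr_fun h c)

/-- The trace functionals of a finite-dimensional semisimple algebra jointly define a
nondegenerate form. -/
theorem eq_zero_of_forall_trace_mul_eq_zero (F : Type*) {A : Type*} [Field F] [Ring A]
    [Algebra F A] [FiniteDimensional F A] [IsSemisimpleRing A] (x : A)
    (hx : ∀ f : A →ₗ[F] F, (∀ a b, f (a * b) = f (b * a)) → ∀ y, f (x * y) = 0) : x = 0 := by
  obtain ⟨n, D, d, _, _, _, hd, ⟨e⟩⟩ :=
    IsSemisimpleRing.exists_algEquiv_pi_matrix_divisionRing_finite F A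
  refine e.injective ?_
  rw [map_zero]
  ext i k l
  by_contra h0
  replace h0 : e x i k l ≠ 0 := h0
  obtain ⟨t, ht, ht0⟩ := exists_ne_zero_trace F (D i)
  have trace_comm (M N : Matrix (Fin (d i)) (Fin (d i)) (D i)) :
      t (M * N).trace = t (N * M).trace := by
    simp only [Matrix.trace, Matrix.diag, Matrix.mul_apply, map_sum]
    rw [Finset.sum_comm]
    simp_rw [ht]
  let f : A →ₗ[F] F := t ∘ₗ Matrix.traceLinearMap (Fin (d i)) F (D i) ∘ₗ
    ((Pi.evalAlgHom F _ i).comp e.toAlgHom).toLinearMap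
  have hf (a : A) : f a = t (e a i).trace := rfl
  refine ht0 (LinearMap.ext fun c ↦ ?_)
  have := hx f (fun a b ↦ by simp only [hf, map_mul, Pi.mul_apply, trace_comm])
    (e.symm (Pi.single i (Matrix.single l k ((e x i k l)⁻¹ * c))))
  simpa [hf, Matrix.trace_mul_single, h0] using this

/-- A finite-dimensional semisimple algebra is a semisimple bimodule over itself. -/
theorem isSemisimpleModule_tensorProduct_mulOpposite (F A : Type*) [Field F] [Ring A]
    [Algebra F A] [IsSemisimpleRing A] : IsSemisimpleModule (A ⊗[F] Aᵐᵒᵖ) A := by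
  let toIdeal (N : Submodule (A ⊗[F] Aᵐᵒᵖ) A) : fullyInvariantSubmodule A A :=
    ⟨{ N with
        smul_mem' := fun a x hx ↦ by
          simpa [TensorProduct.Algebra.smul_def] using
            N.smul_mem (a ⊗ₜ[F] (1 : Aᵐᵒᵖ)) hx },
      isFullyInvariant_iff_isTwoSided.mpr ⟨fun b hx ↦ by
        simpa [TensorProduct.Algebra.smul_def] using
          N.smul_mem ((1 : A) ⊗ₜ[F] MulOpposite.op b) hx⟩⟩
  let ofIdeal (I : fullyInvariantSubmodule A A) : Submodule (A ⊗[F] Aᵐᵒᵖ) A :=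
    { I.1 with
      smul_mem' := fun r x hx ↦ by
        have := isFullyInvariant_iff_isTwoSided.mp I.2
        induction r with
        | zero => exact (zero_smul (A ⊗[F] Aᵐᵒᵖ) x).symm ▸ I.1.zero_mem
        | add r s hr hs => rw [add_smul]; exact I.1.add_mem hr hs
        | tmul a b =>
          rw [TensorProduct.Algebra.smul_def]
          exact I.1.smul_mem a (this.mul_mem_of_left b.unop hx) }
  let e : Submodule (A ⊗[F] Aᵐᵒᵖ) A ≃o fullyInvariantSubmodule A A :=
    { toFun := toIdeal
      invFun := ofIdeal
      left_inv := fun _ ↦ rfl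
      right_inv := fun _ ↦ rfl
      map_rel_iff' := Iff.rfl }
  rw [isSemisimpleModule_iff]
  exact (e.trans OrderIso.setIsotypicComponents.symm).symm.complementedLattice

/-- A linear endomorphism of a finite-dimensional semisimple algebra which is linear over the
center belongs to the multiplication algebra. -/
theorem exists_eq_sum_mul_mul_of_map_mul_center {F A : Type*} [Field F] [Ring A]
    [Algebra F A] [FiniteDimensional F A] [IsSemisimpleRing A] (T : A →ₗ[F] A)
    (hT : ∀ z ∈ Subring.center A, ∀ x, T (x * z) = T x * z) :
    ∃ (n : ℕ) (a b : Fin n → A), ∀ x : A, T x = ∑ i, a i * x * b i := by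
  have := isSemisimpleModule_tensorProduct_mulOpposite F A
  have left (g : Module.End (A ⊗[F] Aᵐᵒᵖ) A) (a x : A) : g (a * x) = a * g x := by
    simpa [TensorProduct.Algebra.smul_def] using g.map_smul (a ⊗ₜ[F] (1 : Aᵐᵒᵖ)) x
  have right (g : Module.End (A ⊗[F] Aᵐᵒᵖ) A) (b x : A) : g (x * b) = g x * b := by
    simpa [TensorProduct.Algebra.smul_def] using
      g.map_smul ((1 : A) ⊗ₜ[F] MulOpposite.op b) x
  have apply_eq (g : Module.End (A ⊗[F] Aᵐᵒᵖ) A) (x : A) : g x = x * g 1 := by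
    simpa using left g x 1
  have central (g : Module.End (A ⊗[F] Aᵐᵒᵖ) A) : g 1 ∈ Subring.center A :=
    Subring.mem_center_iff.mpr fun x ↦ by
      rw [← apply_eq]
      simpa using right g x 1
  let T' : Module.End (Module.End (A ⊗[F] Aᵐᵒᵖ) A) A :=
    { toFun := T
      map_add' := T.map_add
      map_smul' := fun g x ↦ by
        simp only [Module.End.smul_def, RingHom.id_apply]
        rw [apply_eq g x, apply_eq g (T x), hT _ (central g)] }
  let B := Module.finBasis F A
  classical
  obtain ⟨r, hr⟩ := jacobson_density T' (Finset.univ.image B)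
  obtain ⟨n, a, b, rfl⟩ := TensorProduct.exists_sum_tmul_eq r
  refine ⟨n, a, fun i ↦ (b i).unop, fun x ↦ ?_⟩
  have : T = ∑ i, LinearMap.mulLeftRight F (a i, (b i).unop) := B.ext fun j ↦ by
    have := hr (B j) (by simp)
    simpa [Finset.sum_smul, TensorProduct.Algebra.smul_def, T', mul_assoc] using this
  simp [this]

/-- A linear map preserving the traces of squares and of cubes preserves the traces of the
products `x * y` and `x * x * y`. -/
theorem trace_mul_and_trace_sq_mul_of_trace_pow {F A : Type*} [Field F] [Ring A]
    [Algebra F A] (h2 : (2 : F) ≠ 0) (h3 : (3 : F) ≠ 0) (T : A →ₗ[F] A) (f : A →ₗ[F] F)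
    (hf : ∀ x y, f (x * y) = f (y * x)) (hT2 : ∀ x, f (T x * T x) = f (x * x))
    (hT3 : ∀ x, f (T x * T x * T x) = f (x * x * x)) (x y : A) :
    f (T x * T y) = f (x * y) ∧ f (T x * T x * T y) = f (x * x * y) := by
  have sq (u v : A) : f ((u + v) * (u + v)) = f (u * u) + f (v * v) + 2 * f (u * v) := by
    simp only [add_mul, mul_add, map_add, hf v u]
    ring
  have cube (u v : A) : f ((u + v) * (u + v) * (u + v)) =
      f (u * u * u) + f (v * v * v) + 3 * f (u * u * v) + 3 * f (v * v * u) := by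
    have h1 : f (u * v * u) = f (u * u * v) := by rw [hf, mul_assoc]
    have h2 : f (v * u * u) = f (u * u * v) := by rw [mul_assoc, hf]
    have h3 : f (v * u * v) = f (v * v * u) := by rw [hf, mul_assoc]
    have h4 : f (u * v * v) = f (v * v * u) := by rw [mul_assoc, hf]
    simp only [add_mul, mul_add, map_add, h1, h2, h3, h4]
    ring
  constructor
  · have h := hT2 (x + y)
    rw [map_add, sq, sq, hT2, hT2] at h
    exact mul_left_cancel₀ h2 (add_left_cancel h)
  · have hp := hT3 (x + y)
    have hm := hT3 (-x + y)
    rw [map_add, cube, cube, hT3, hT3] at hp hm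
    simp only [map_neg, neg_mul, mul_neg, neg_neg] at hm
    refine mul_left_cancel₀ (mul_ne_zero h2 h3) ?_
    linear_combination hp + hm

/-- **Corollary 3.9.** Let `A` be a finite-dimensional semisimple algebra over a field `F`
with `char F ≠ 2, 3`. Then every local inner automorphism `T : A → A` is a Jordan
automorphism belonging to the multiplication algebra of `A`. -/
theorem local_inner_automorphism_is_jordan (F A : Type*) [Field F] [Ring A]
    [Algebra F A] [FiniteDimensional F A] [IsSemisimpleRing A]
    (h2 : (2 : F) ≠ 0) (h3 : (3 : F) ≠ 0) (T : A →ₗ[F] A)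
    (hloc : ∀ x : A, ∃ u : Aˣ, T x = (u : A) * x * ((u⁻¹ : Aˣ) : A)) :
    Function.Bijective T ∧
      (∀ x y : A, T (x * y + y * x) = T x * T y + T y * T x) ∧
      (∃ (n : ℕ) (a b : Fin n → A), ∀ x : A, T x = ∑ i, a i * x * b i) := by
  have inj : Function.Injective T := by
    refine (injective_iff_map_eq_zero T).mpr fun x hx ↦ ?_
    obtain ⟨u, hu⟩ := hloc x
    simpa [hx, eq_comm] using hu
  have surj : Function.Surjective T := LinearMap.injective_iff_surjective.mp inj
  have sq (x : A) : T (x * x) = T x * T x := by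
    refine (sub_eq_zero.mp (eq_zero_of_forall_trace_mul_eq_zero F _ fun f hf y ↦ ?_)).symm
    have hconj (u : Aˣ) (x : A) : f (u * x * (u⁻¹ : Aˣ)) = f x := by
      rw [hf, ← mul_assoc, Units.inv_mul, one_mul]
    have hT2 (x : A) : f (T x * T x) = f (x * x) := by
      obtain ⟨u, hu⟩ := hloc x
      rw [hu, ← hconj u (x * x)]
      simp [mul_assoc]
    have hT3 (x : A) : f (T x * T x * T x) = f (x * x * x) := by
      obtain ⟨u, hu⟩ := hloc x
      rw [hu, ← hconj u (x * x * x)]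
      simp [mul_assoc]
    have key := trace_mul_and_trace_sq_mul_of_trace_pow h2 h3 T f hf hT2 hT3
    obtain ⟨y, rfl⟩ := surj y
    rw [sub_mul, map_sub, (key x y).2, (key (x * x) y).1, sub_self]
  have jordan (x y : A) : T (x * y + y * x) = T x * T y + T y * T x := by
    have h := sq (x + y)
    simp only [add_mul, mul_add, map_add, sq] at h ⊢
    rw [← sub_eq_zero] at h ⊢
    rw [← h]
    abel
  refine ⟨⟨inj, surj⟩, jordan, exists_eq_sum_mul_mul_of_map_mul_center T fun z hz x ↦ ?_⟩
  have hz' := Subring.mem_center_iff.mp hz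
  have hTz : T z = z := by
    obtain ⟨u, hu⟩ := hloc z
    rw [hu, hz', mul_assoc, Units.mul_inv, mul_one]
  have h := jordan x z
  rw [hTz, ← hz' x, ← hz' (T x), ← two_smul F, ← two_smul F, map_smul] at h
  exact smul_right_injective A h2 h
end

section
/- Let A be a finite-dimensional simple algebra over a field F with char(F) ≠ 2 and char(F) ≠ 3. If T : A → A is a linear map such that for every x ∈ A there exists a Jordan automorphism T_x of A with T(x) = T_x(x) (a local Jordan automorphism), then T is a Jordan automorphism of A. -/
open scoped TensorProduct in
theorem isSimpleRing_tensorProduct (K L A : Type*) [Field K] [Field L] [Algebra K L] [Ring A]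
    [Algebra K A] [Algebra.IsCentral K A] [IsSimpleRing A] : IsSimpleRing (L ⊗[K] A) := by
  classical
  let b := Module.Basis.ofVectorSpace K L
  let e := TensorProduct.equivFinsuppOfBasisLeft (N := A) b
  have he_left (a : A) (w : L ⊗[K] A) (i) : e ((1 ⊗ₜ a) * w) i = a * e w i := by
    induction w with
    | zero => simp
    | tmul l x => simp [e]
    | add x y hx hy => simp [mul_add, hx, hy]
  have he_right (a : A) (w : L ⊗[K] A) (i) : e (w * (1 ⊗ₜ a)) i = e w i * a := by
    induction w with
    | zero => simp
    | tmul l x => simp [e]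
    | add x y hx hy => simp [add_mul, hx, hy]
  refine IsSimpleRing.of_eq_bot_or_eq_top fun I => or_iff_not_imp_left.2 fun hI => ?_
  have hne : ∃ n, ∃ w ∈ I, w ≠ 0 ∧ (e w).support.card = n := by
    by_contra! h
    refine hI (le_antisymm (fun w hw => ?_) bot_le)
    by_contra hw0
    exact h _ w hw (fun h0 => hw0 (h0 ▸ zero_mem _)) rfl
  obtain ⟨w, hwI, hw0, hcard⟩ := Nat.find_spec hne
  have hmin : ∀ v ∈ I, (e v).support.card < (e w).support.card → v = 0 := by
    intro v hv hlt
    by_contra hv0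
    exact Nat.find_min hne (hcard ▸ hlt) ⟨v, hv, hv0, rfl⟩
  have hew : e w ≠ 0 := by simpa using hw0
  obtain ⟨i, hi⟩ := Finsupp.ne_iff.1 hew
  let J : TwoSidedIdeal A := .mk' {a | ∃ v ∈ I, (e v).support ⊆ (e w).support ∧ e v i = a}
    ⟨0, I.zero_mem, by simp, by simp⟩
    (by
      rintro _ _ ⟨v, hv, hvs, rfl⟩ ⟨v', hv', hvs', rfl⟩
      refine ⟨v + v', I.add_mem hv hv', ?_, by simp⟩
      rw [map_add]
      exact Finsupp.support_add.trans (Finset.union_subset hvs hvs'))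
    (by
      rintro _ ⟨v, hv, hvs, rfl⟩
      exact ⟨-v, I.neg_mem hv, by simpa [Finsupp.support_neg] using hvs, by simp⟩)
    (by
      rintro x _ ⟨v, hv, hvs, rfl⟩
      refine ⟨(1 ⊗ₜ x) * v, I.mul_mem_left _ _ hv, fun j hj => hvs ?_, he_left _ _ _⟩
      rw [Finsupp.mem_support_iff, he_left] at hj
      exact Finsupp.mem_support_iff.2 (right_ne_zero_of_mul hj))
    (by
      rintro _ y ⟨v, hv, hvs, rfl⟩
      refine ⟨v * (1 ⊗ₜ y), I.mul_mem_right _ _ hv, fun j hj => hvs ?_, he_right _ _ _⟩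
      rw [Finsupp.mem_support_iff, he_right] at hj
      exact Finsupp.mem_support_iff.2 (left_ne_zero_of_mul hj))
  have hJ : (1 : A) ∈ J :=
    IsSimpleRing.one_mem_of_ne_zero_mem J hi ((TwoSidedIdeal.mem_mk' ..).2
      ⟨w, hwI, subset_rfl, rfl⟩)
  obtain ⟨v, hvI, hvs, hv1⟩ := (TwoSidedIdeal.mem_mk' ..).1 hJ
  have hcomm (a : A) : (1 ⊗ₜ a) * v - v * (1 ⊗ₜ a) = 0 := by
    refine hmin _ (I.sub_mem (I.mul_mem_left _ _ hvI) (I.mul_mem_right _ _ hvI))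
      (Finset.card_lt_card ⟨fun j hj => hvs ?_, fun h => ?_⟩)
    · rw [Finsupp.mem_support_iff, map_sub, Finsupp.sub_apply, he_left, he_right] at hj
      rw [Finsupp.mem_support_iff]
      rintro h0
      simp [h0] at hj
    · have := h (Finsupp.mem_support_iff.2 hi)
      rw [Finsupp.mem_support_iff, map_sub, Finsupp.sub_apply, he_left, he_right, hv1] at this
      simp at this
  have hcent (j) : ∃ k : K, algebraMap K A k = e v j := by
    have : e v j ∈ Subalgebra.center K A := Subalgebra.mem_center_iff.2 fun a => by
      have := congrArg (fun z => e z j) (hcomm a)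
      simpa [he_left, he_right, sub_eq_zero] using this
    exact Algebra.mem_bot.1 (Algebra.IsCentral.out this)
  choose k hk using hcent
  have hv : v = ((e v).sum fun j _ => k j • b j) ⊗ₜ[K] (1 : A) := by
    conv_lhs => rw [← e.symm_apply_apply v]
    rw [TensorProduct.equivFinsuppOfBasisLeft_symm_apply, Finsupp.sum, Finsupp.sum,
      TensorProduct.sum_tmul]
    refine Finset.sum_congr rfl fun j _ => ?_
    rw [TensorProduct.smul_tmul, ← hk, Algebra.algebraMap_eq_smul_one]
  set l := (e v).sum fun j _ => k j • b j
  have hl : l ≠ 0 := by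
    rintro h
    rw [h, TensorProduct.zero_tmul] at hv
    simp [hv] at hv1
  have h1 : (1 : L ⊗[K] A) ∈ I := by
    have := I.mul_mem_left (l⁻¹ ⊗ₜ 1) _ hvI
    rwa [hv, Algebra.TensorProduct.tmul_mul_tmul, inv_mul_cancel₀ hl, mul_one,
      ← Algebra.TensorProduct.one_def] at this
  exact I.one_mem_iff.1 h1

theorem exists_matrix_algHom_basis (K L A : Type*) [Field K] [Field L] [Algebra K L]
    [IsAlgClosed L] [Ring A] [Algebra K A] [Algebra.IsCentral K A] [IsSimpleRing A]
    [FiniteDimensional K A] {ι : Type*} (b : Module.Basis ι K A) :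
    ∃ (n : ℕ) (_ : NeZero n) (φ : A →ₐ[K] Matrix (Fin n) (Fin n) L)
      (c : Module.Basis ι L (Matrix (Fin n) (Fin n) L)), ∀ i, c i = φ (b i) := by
  have := isSimpleRing_tensorProduct K L A
  obtain ⟨n, hn, ⟨e⟩⟩ := IsSimpleRing.exists_algEquiv_matrix_of_isAlgClosed L (TensorProduct K L A)
  exact ⟨n, hn, (e.toAlgHom.restrictScalars K).comp Algebra.TensorProduct.includeRight,
    (b.baseChange L).map e.toLinearEquiv, fun i => by simp⟩

theorem Polynomial.Monic.eq_of_pow_eq_pow {R : Type*} [Field R] {p q : Polynomial R}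
    (hp : p.Monic) (hq : q.Monic) {m : ℕ} (hm : m ≠ 0) (h : p ^ m = q ^ m) : p = q :=
  eq_of_monic_of_associated hp hq (associated_of_dvd_dvd
    ((IsIntegrallyClosed.pow_dvd_pow_iff hm).1 h.dvd)
    ((IsIntegrallyClosed.pow_dvd_pow_iff hm).1 h.symm.dvd))

theorem Matrix.det_mulLeftRight_self {R n : Type*} [Field R] [Fintype n] [DecidableEq n]
    (x : Matrix n n R) :
    LinearMap.det (LinearMap.mulLeftRight R (x, x)) =
      x.det ^ (2 * Fintype.card n) := by
  let v : Matrix n n R ≃ₗ[R] (n × n → R) :=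
    LinearEquiv.ofBijective ⟨⟨vec, vec_add⟩, vec_smul⟩ vec_bijective
  rw [← LinearMap.det_conj _ v]
  have : (v : Matrix n n R →ₗ[R] (n × n → R)) ∘ₗ LinearMap.mulLeftRight R (x, x) ∘ₗ v.symm =
      Matrix.toLin' (Matrix.kronecker x.transpose x) := by
    refine LinearMap.ext fun y => ?_
    obtain ⟨y, rfl⟩ := v.surjective y
    have := kronecker_mulVec_vec x y x.transpose
    rw [LinearMap.comp_apply, LinearMap.comp_apply, LinearEquiv.coe_coe, LinearEquiv.coe_coe,
      v.symm_apply_apply, LinearMap.mulLeftRight_apply]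
    rw [transpose_transpose] at this
    exact this.symm
  rw [this, LinearMap.det_toLin', kronecker, Matrix.det_kronecker, Matrix.det_transpose,
    ← pow_add, two_mul]

theorem eq_of_add_self_eq_add_self {F V : Type*} [Field F] [AddCommGroup V] [Module F V]
    (h2 : (2 : F) ≠ 0) (a b : V) (h : a + a = b + b) : a = b := by
  rw [← two_smul F, ← two_smul F] at h
  exact smul_right_injective _ h2 h

/-- An additive map preserving the Jordan product `x * y + y * x`. -/
structure IsJordanMap {A B : Type*} [Ring A] [Ring B] (S : A →+ B) : Prop where
  map_jordan : ∀ x y, S (x * y + y * x) = S x * S y + S y * S x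

namespace IsJordanMap

section Ring

variable {A B : Type*} [Ring A] [Ring B] {S : A →+ B}

theorem map_bracket_bracket (hS : IsJordanMap S) (x y z : A) :
    S ⁅⁅x, y⁆, z⁆ = ⁅⁅S x, S y⁆, S z⁆ := by
  simp only [Ring.lie_def]
  rw [show (x * y - y * x) * z - z * (x * y - y * x) =
      ((y * z + z * y) * x + x * (y * z + z * y)) -
        ((x * z + z * x) * y + y * (x * z + z * x)) by noncomm_ring,
    map_sub, hS.map_jordan, hS.map_jordan, hS.map_jordan, hS.map_jordan]
  noncomm_ring

theorem map_mul_self (hS : IsJordanMap S) (h2 : ∀ a b : B, a + a = b + b → a = b) (x : A) :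
    S (x * x) = S x * S x := by
  apply h2
  rw [← map_add, hS.map_jordan]

theorem map_mul_mul_self (hS : IsJordanMap S) (h2 : ∀ a b : B, a + a = b + b → a = b) (x y : A) :
    S (x * y * x) = S x * S y * S x := by
  apply h2
  rw [← map_add, show x * y * x + x * y * x = (x * (x * y + y * x) + (x * y + y * x) * x) -
    (x * x * y + y * (x * x)) by noncomm_ring, map_sub, hS.map_jordan, hS.map_jordan,
    hS.map_jordan, hS.map_mul_self h2]
  noncomm_ring

theorem map_one (hS : IsJordanMap S) (h2 : ∀ a b : B, a + a = b + b → a = b)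
    (hsurj : Function.Surjective S) : S 1 = 1 := by
  obtain ⟨x, hx⟩ := hsurj 1
  have := hS.map_jordan 1 x
  rw [one_mul, mul_one, map_add, hx, mul_one, one_mul] at this
  exact (h2 _ _ this).symm

theorem commute_apply_of_commute (hS : IsJordanMap S) (h2 : ∀ a b : B, a + a = b + b → a = b)
    (hsurj : Function.Surjective S) (hB : ∀ z w : B, (∀ y, Commute z y) → z * w = 0 → z = 0 ∨ w = 0)
    {c : A} (hc : ∀ x, Commute c x) (y : B) : Commute (S c) y := by
  have hd (w u : B) : Commute ⁅S c, w⁆ u := by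
    obtain ⟨w, rfl⟩ := hsurj w
    obtain ⟨u, rfl⟩ := hsurj u
    have := hS.map_bracket_bracket c w u
    rw [commute_iff_lie_eq.1 (hc w), Ring.lie_def 0, zero_mul, mul_zero, sub_zero, map_zero] at this
    exact (commute_iff_lie_eq).2 this.symm
  rw [commute_iff_lie_eq]
  by_contra hne
  refine hne ?_
  have hsq : ⁅S c, y * y⁆ = ⁅S c, y⁆ * y + ⁅S c, y⁆ * y := by
    nth_rewrite 2 [(hd y y).eq]
    simp only [Ring.lie_def]
    noncomm_ring
  have key (u : B) : ⁅S c, y⁆ * ⁅y, u⁆ = 0 := by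
    apply h2
    have h := (commute_iff_lie_eq).1 (hd (y * y) u)
    rw [hsq] at h
    have h' := (hd y u).eq
    rw [add_zero, ← h]
    generalize ⁅S c, y⁆ = d at h' ⊢
    simp only [Ring.lie_def, add_mul, mul_add, mul_sub, ← mul_assoc, ← h']
    abel
  have hy : ⁅y, S c⁆ = 0 := ((hB _ _ (hd y)) (key (S c))).resolve_left hne
  rw [Ring.lie_def, sub_eq_zero] at hy ⊢
  exact hy.symm

end Ring

theorem trace_apply {L n : Type*} [Field L] [Infinite L] [Fintype n] [DecidableEq n]
    (h2 : (2 : L) ≠ 0) {J : Matrix n n L ≃ₗ[L] Matrix n n L}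
    (hJ : IsJordanMap (J : Matrix n n L →+ Matrix n n L)) (x : Matrix n n L) :
    (J x).trace = x.trace := by
  have h2' := eq_of_add_self_eq_add_self (V := Matrix n n L) h2
  rcases isEmpty_or_nonempty n with hn | hn
  · simp [Matrix.trace]
  have hdet (y : Matrix n n L) :
      (J y).det ^ (2 * Fintype.card n) = y.det ^ (2 * Fintype.card n) := by
    rw [← Matrix.det_mulLeftRight_self, ← Matrix.det_mulLeftRight_self,
      ← LinearMap.det_conj (LinearMap.mulLeftRight L (y, y)) J]
    congr 1
    refine LinearMap.ext fun z => ?_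
    obtain ⟨z, rfl⟩ := J.surjective z
    simpa using (hJ.map_mul_mul_self h2' y z).symm
  have hone : J 1 = 1 := hJ.map_one h2' J.surjective
  have hchar : (J x).charpoly = x.charpoly := by
    refine (Matrix.charpoly_monic _).eq_of_pow_eq_pow (Matrix.charpoly_monic _)
      (m := 2 * Fintype.card n) (by simp) (Polynomial.funext fun t => ?_)
    rw [Polynomial.eval_pow, Polynomial.eval_pow, Matrix.eval_charpoly, Matrix.eval_charpoly,
      ← hdet (Matrix.scalar n t - x), map_sub]
    congr 3
    rw [show Matrix.scalar n t = t • 1 by ext; simp [Matrix.one_apply, Matrix.diagonal],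
      map_smul, hone]
  rw [Matrix.trace_eq_neg_charpoly_nextCoeff, hchar, Matrix.trace_eq_neg_charpoly_nextCoeff]

theorem trace_map_algHom {K L A ι n : Type*} [Field K] [Field L] [Infinite L] [Algebra K L]
    (h2 : (2 : L) ≠ 0) [Ring A] [Algebra K A] [Fintype ι] [Fintype n] [DecidableEq n]
    (b : Module.Basis ι K A) (φ : A →ₐ[K] Matrix n n L) (c : Module.Basis ι L (Matrix n n L))
    (hc : ∀ i, c i = φ (b i)) {S : A →+ A} (hS : IsJordanMap S) (hsurj : Function.Surjective S)
    (σ : K → K) (hσ : ∀ k x, S (k • x) = σ k • S x) (g : L ≃+* L)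
    (hg : ∀ k, g (algebraMap K L k) = algebraMap K L (σ k)) (x : A) :
    (φ (S x)).trace = g (φ x).trace := by
  let ψ : Matrix n n L ≃+* Matrix n n L := g.symm.mapMatrix
  have hψ_smul (r : L) (m : Matrix n n L) : ψ (r • m) = g.symm r • ψ m := by
    ext; simp [ψ]
  have hψ_algebraMap (k : K) (m : Matrix n n L) : ψ (σ k • m) = k • ψ m := by
    rw [← algebraMap_smul L, hψ_smul, ← hg, g.symm_apply_apply, algebraMap_smul]
  let J₀ : Matrix n n L →ₗ[L] Matrix n n L := c.constr L fun i => ψ (φ (S (b i)))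
  have hJ₀_basis (i) : J₀ (φ (b i)) = ψ (φ (S (b i))) := by
    rw [← hc, Module.Basis.constr_basis]
  have hJ₀ (x : A) : J₀ (φ x) = ψ (φ (S x)) := by
    rw [← b.sum_repr x]
    simp only [map_sum, hσ, map_smul, hψ_algebraMap, LinearMap.map_smul_of_tower, hJ₀_basis]
  have hJ₀_surj : Function.Surjective J₀ := by
    intro m
    choose y hy using fun i => hsurj (b i)
    refine ⟨∑ i, g.symm (c.repr (ψ.symm m) i) • φ (y i), ?_⟩
    simp only [map_sum, map_smul, hJ₀, hy, ← hc, ← hψ_smul]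
    rw [← map_sum, c.sum_repr, ψ.apply_symm_apply]
  let J : Matrix n n L ≃ₗ[L] Matrix n n L :=
    .ofBijective J₀ ⟨LinearMap.injective_iff_surjective.2 hJ₀_surj, hJ₀_surj⟩
  have hJ : IsJordanMap (J : Matrix n n L →+ Matrix n n L) := by
    refine ⟨fun u v => ?_⟩
    let μ : Matrix n n L →ₗ[L] Matrix n n L →ₗ[L] Matrix n n L :=
      LinearMap.mul L _ + (LinearMap.mul L _).flip
    have : μ.compr₂ J₀ = μ.compl₁₂ J₀ J₀ := by
      refine LinearMap.ext_basis c c fun i j => ?_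
      simp only [μ, LinearMap.compr₂_apply, LinearMap.compl₁₂_apply, LinearMap.add_apply,
        LinearMap.flip_apply, LinearMap.mul_apply', hc, ← map_mul, ← map_add, hJ₀, hS.map_jordan]
    exact congr($this u v)
  have htrace := trace_apply h2 hJ (φ x)
  rw [show J (φ x) = ψ (φ (S x)) from hJ₀ x] at htrace
  rw [← htrace]
  simp [ψ, Matrix.trace, map_sum]

end IsJordanMap

theorem IsJordanMap.exists_algEquiv_map_smul {F K A : Type*} [Field F] [Field K] [Algebra F K]
    [FiniteDimensional F K] [Ring A] [Nontrivial A] [Algebra F A] [Algebra K A]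
    [IsScalarTower F K A] [Algebra.IsCentral K A] (h2 : (2 : F) ≠ 0) {S : A →ₗ[F] A}
    (hS : IsJordanMap (S : A →+ A)) (hsurj : Function.Surjective S) :
    ∃ σ : K ≃ₐ[F] K, ∀ k x, S (k • x) = σ k • S x := by
  have h2' := eq_of_add_self_eq_add_self (V := A) h2
  have hcentral (z : A) (hz : ∀ y, Commute z y) : ∃ k : K, algebraMap K A k = z :=
    Algebra.mem_bot.1 (Algebra.IsCentral.out
      (Subalgebra.mem_center_iff.2 fun y => (hz y).eq.symm))
  have hsmul (k : K) : ∃ k' : K, algebraMap K A k' = S (algebraMap K A k) := by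
    refine hcentral _ (hS.commute_apply_of_commute h2' hsurj (fun z w hz hzw => ?_)
      (Algebra.commutes k))
    obtain ⟨l, rfl⟩ := hcentral z hz
    rw [← Algebra.smul_def, smul_eq_zero] at hzw
    exact hzw.imp (fun h => by rw [h, map_zero]) id
  choose σ hσ using hsmul
  have hσ_smul (k : K) (x : A) : S (k • x) = σ k • S x := by
    apply h2'
    have := hS.map_jordan (algebraMap K A k) x
    rw [← Algebra.commutes k x, ← Algebra.smul_def] at this
    simp only [AddMonoidHom.coe_coe, map_add] at this
    rw [this, ← hσ, ← Algebra.commutes, Algebra.smul_def]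
  have hone : S 1 = 1 := hS.map_one h2' hsurj
  have hinj := FaithfulSMul.algebraMap_injective K A
  let σ' : K →ₐ[F] K := AlgHom.ofLinearMap
    { toFun := σ
      map_add' := fun x y => hinj (by simp only [hσ, map_add])
      map_smul' := fun r x => hinj (by
        rw [RingHom.id_apply, hσ, Algebra.algebraMap_eq_smul_one, smul_assoc,
          ← Algebra.algebraMap_eq_smul_one, map_smul, ← hσ, Algebra.algebraMap_eq_smul_one,
          Algebra.algebraMap_eq_smul_one, smul_assoc]) }
    (hinj (by simp [hσ, hone]))
    (fun x y => hinj (by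
      simp only [LinearMap.coe_mk, AddHom.coe_mk]
      rw [hσ, map_mul, ← Algebra.smul_def, hσ_smul, map_mul, hσ y, Algebra.smul_def]))
  exact ⟨AlgEquiv.ofBijective σ' (Algebra.IsAlgebraic.algHom_bijective σ'), hσ_smul⟩

/-- A central simple `K`-algebra has a nondegenerate trace form invariant under all `F`-linear Jordan
automorphisms, namely the sum of the conjugates of the reduced trace under `K ≃ₐ[F] K`. -/
theorem exists_jordan_invariant_trace (F K A : Type*) [Field F] [Field K] [Algebra F K]
    [Ring A] [IsSimpleRing A] [Algebra F A] [Algebra K A] [FiniteDimensional F A]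
    [IsScalarTower F K A] [Algebra.IsCentral K A] (h2 : (2 : F) ≠ 0) :
    ∃ q : A →+ AlgebraicClosure K, (∀ x y, q (x * y) = q (y * x)) ∧
      (∀ w, (∀ z, q (w * z) = 0) → w = 0) ∧
      ∀ S : A →ₗ[F] A, Function.Surjective S → IsJordanMap (S : A →+ A) →
        ∀ x, q (S x) = q x := by
  have : FiniteDimensional F K := FiniteDimensional.left F K A
  have : FiniteDimensional K A := .right F K A
  let L := AlgebraicClosure K
  have : IsAlgClosure F L := ⟨inferInstance, Algebra.IsAlgebraic.trans F K L⟩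
  have h2L : (2 : L) ≠ 0 := by
    rw [← map_ofNat (algebraMap F L)]
    exact (map_ne_zero _).2 h2
  let b := Module.finBasis K A
  obtain ⟨n, hn, φ, c, hc⟩ := exists_matrix_algHom_basis K L A b
  let lift (τ : K ≃ₐ[F] K) : L ≃ₐ[F] L := τ.liftNormal L
  have hlift (τ) (k : K) : lift τ (algebraMap K L k) = algebraMap K L (τ k) :=
    τ.liftNormal_commutes L k
  let q : A →+ L := AddMonoidHom.mk' (fun x => ∑ τ : K ≃ₐ[F] K, lift τ (φ x).trace) fun x y => by
    simp only [map_add, Matrix.trace_add, Finset.sum_add_distrib]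
  have hq (x) : q x = ∑ τ : K ≃ₐ[F] K, lift τ (φ x).trace := rfl
  refine ⟨q, fun x y => ?_, fun w hw => ?_, fun S hsurj hS x => ?_⟩
  · simp only [hq, map_mul, Matrix.trace_mul_comm (φ x)]
  · have hind : LinearIndependent L fun τ : K ≃ₐ[F] K =>
        (((algebraMap K L).comp (τ : K →+* K) : K →* L) : K → L) :=
      (linearIndependent_monoidHom K L).comp
        (fun τ : K ≃ₐ[F] K => (((algebraMap K L).comp (τ : K →+* K) : K →+* L) : K →* L))
        fun τ τ' h => AlgEquiv.ext fun k => (algebraMap K L).injective congr($h k)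
    have htrace (z : A) : (φ w * φ z).trace = 0 := by
      have := Fintype.linearIndependent_iff.1 hind (fun τ => lift τ (φ w * φ z).trace) (by
        funext k
        have := hw (k • z)
        rw [hq] at this
        rw [Pi.zero_apply, ← this, Finset.sum_apply]
        refine Finset.sum_congr rfl fun τ _ => ?_
        rw [map_mul, map_smul, mul_smul_comm, ← algebraMap_smul L k, Matrix.trace_smul,
          smul_eq_mul, map_mul, hlift, mul_comm]
        rfl) 1
      exact (map_eq_zero_iff _ (lift 1).injective).1 this
    have hφw : φ w = 0 := by
      refine Matrix.ext_iff_trace_mul_right.2 fun m => ?_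
      rw [← c.sum_repr m]
      simp [Matrix.mul_sum, Matrix.trace_sum, hc, htrace]
    exact (map_eq_zero_iff φ φ.toRingHom.injective).1 hφw
  · obtain ⟨σ, hσ⟩ := hS.exists_algEquiv_map_smul (K := K) h2 hsurj
    rw [hq, hq, ← Equiv.sum_comp (Equiv.mulRight σ) fun τ => lift τ (φ x).trace]
    refine Finset.sum_congr rfl fun τ _ => ?_
    have := IsJordanMap.trace_map_algHom h2L b φ c hc hS hsurj σ hσ
      ((lift (τ * σ)).trans (lift τ).symm).toRingEquiv (fun k => by
        simp [hlift, AlgEquiv.symm_apply_eq]) x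
    rw [show φ (S x) = φ ((S : A →+ A) x) from rfl, this]
    simp

theorem cubic_polarization {A B : Type*} [Ring A] [AddCommGroup B] (q : A →+ B)
    (hq : ∀ x y, q (x * y) = q (y * x)) (x y z : A) :
    q ((x + y + z) * ((x + y + z) * (x + y + z))) - q ((x + y) * ((x + y) * (x + y)))
      - q ((y + z) * ((y + z) * (y + z))) - q ((x + z) * ((x + z) * (x + z)))
      + q (x * (x * x)) + q (y * (y * y)) + q (z * (z * z)) = 3 • q ((x * y + y * x) * z) := by
  have h1 : q (x * (z * y)) = q (y * (x * z)) := by rw [← mul_assoc, hq]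
  have h2 : q (z * (y * x)) = q (y * (x * z)) := by rw [hq, mul_assoc]
  have h3 : q (y * (z * x)) = q (x * (y * z)) := by rw [← mul_assoc, hq]
  have h4 : q (z * (x * y)) = q (x * (y * z)) := by rw [hq, mul_assoc]
  simp only [add_mul, mul_add, map_add, mul_assoc, h1, h2, h3, h4]
  abel

theorem isJordanMap_of_preserves_trace_powers {A B : Type*} [Ring A] [AddCommGroup B]
    (h2 : ∀ a b : B, a + a = b + b → a = b) (h3 : ∀ a b : B, 3 • a = 3 • b → a = b)
    (q : A →+ B) (hq : ∀ x y, q (x * y) = q (y * x)) (hnd : ∀ w, (∀ z, q (w * z) = 0) → w = 0)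
    (T : A →+ A) (hT : Function.Surjective T) (hsq : ∀ x, q (T x * T x) = q (x * x))
    (hcube : ∀ x, q (T x * (T x * T x)) = q (x * (x * x))) : IsJordanMap T := by
  have hquad (u v : A) : q (T u * T v) = q (u * v) := by
    apply h2
    have := hsq (u + v)
    simp only [map_add, add_mul, mul_add, hsq, hq v u, hq (T v) (T u)] at this
    have h : q (T u * T v) + q (T u * T v) =
      q (u * u) + q (u * v) + (q (u * v) + q (v * v)) - q (u * u) - q (v * v) := by
        rw [← this]; abel
    rw [h]; abel
  refine ⟨fun x y => ?_⟩
  rw [← sub_eq_zero]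
  refine hnd _ fun w => ?_
  obtain ⟨z, rfl⟩ := hT w
  rw [sub_mul, map_sub, hquad, sub_eq_zero]
  apply h3
  rw [← cubic_polarization q hq, ← cubic_polarization q hq]
  simp only [← map_add, hcube]

theorem local_jordan_of_isCentral {F K A : Type*} [Field F] [Field K] [Algebra F K]
    [Ring A] [IsSimpleRing A] [Algebra F A] [Algebra K A] [FiniteDimensional F A]
    [IsScalarTower F K A] [Algebra.IsCentral K A] (h2 : (2 : F) ≠ 0) (h3 : (3 : F) ≠ 0)
    {T : A →ₗ[F] A} (hT : Function.Surjective T)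
    (hloc : ∀ x : A, ∃ S : A →ₗ[F] A, Function.Surjective S ∧ IsJordanMap (S : A →+ A) ∧
      T x = S x) : IsJordanMap (T : A →+ A) := by
  obtain ⟨q, hq, hnd, hinv⟩ := exists_jordan_invariant_trace F K A h2
  have h2' := eq_of_add_self_eq_add_self (V := A) h2
  refine isJordanMap_of_preserves_trace_powers (eq_of_add_self_eq_add_self h2)
    (fun a b h => ?_) q hq hnd T hT (fun x => ?_) (fun x => ?_)
  · refine smul_right_injective _ h3 ?_
    simpa only [ofNat_smul_eq_nsmul] using h
  · obtain ⟨S, hsurj, hS, hx⟩ := hloc x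
    rw [AddMonoidHom.coe_coe, hx, ← hinv S hsurj hS (x * x)]
    exact congrArg q (hS.map_mul_self h2' x).symm
  · obtain ⟨S, hsurj, hS, hx⟩ := hloc x
    rw [AddMonoidHom.coe_coe, hx, ← hinv S hsurj hS (x * (x * x)), ← mul_assoc, ← mul_assoc]
    exact congrArg q (hS.map_mul_mul_self h2' x x).symm

universe u in
theorem IsSimpleRing.exists_field_isCentral (F : Type*) (A : Type u) [Field F] [Ring A]
    [Algebra F A] [IsSimpleRing A] : ∃ (K : Type u) (_ : Field K) (_ : Algebra F K)
      (_ : Algebra K A), IsScalarTower F K A ∧ Algebra.IsCentral K A := by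
  let Z := Subalgebra.center F A
  have hfield : IsField Z := IsSimpleRing.isField_center A
  let _ : Algebra Z A :=
    (Z.val : Z →+* A).toAlgebra' fun z x => (Subalgebra.mem_center_iff.1 z.2 x).symm
  have htower : IsScalarTower F Z A := .of_algebraMap_eq fun _ => rfl
  have hcentral : Algebra.IsCentral Z A := ⟨fun x hx => Algebra.mem_bot.2
    ⟨⟨x, Subalgebra.mem_center_iff.2 (Subalgebra.mem_center_iff.1 hx)⟩, rfl⟩⟩
  exact ⟨Z, hfield.toField, Z.algebra, ‹_›, htower, hcentral⟩

/-- **Theorem 3.11.** Let `A` be a finite-dimensional simple algebra over a field `F` with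
`char F ≠ 2, 3`. Then every local Jordan automorphism `T : A → A` is a Jordan
automorphism. -/
theorem local_jordan_automorphism_is_jordan (F A : Type*) [Field F] [Ring A]
    [Algebra F A] [FiniteDimensional F A] [IsSimpleRing A]
    (h2 : (2 : F) ≠ 0) (h3 : (3 : F) ≠ 0) (T : A →ₗ[F] A)
    (hloc : ∀ x : A, ∃ S : A →ₗ[F] A, Function.Bijective S ∧
      (∀ u v : A, S (u * v + v * u) = S u * S v + S v * S u) ∧ T x = S x) :
    Function.Bijective T ∧
      ∀ x y : A, T (x * y + y * x) = T x * T y + T y * T x := by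
  have hinj : Function.Injective T := by
    refine (injective_iff_map_eq_zero T).2 fun x hx => ?_
    obtain ⟨S, hS, -, hxS⟩ := hloc x
    exact (map_eq_zero_iff S hS.1).1 (hxS ▸ hx)
  have hsurj : Function.Surjective T := LinearMap.injective_iff_surjective.1 hinj
  obtain ⟨K, _, _, _, _, _⟩ := IsSimpleRing.exists_field_isCentral F A
  refine ⟨⟨hinj, hsurj⟩, (local_jordan_of_isCentral (K := K) h2 h3 hsurj
    fun x => ?_).map_jordan⟩
  obtain ⟨S, hS, hSj, hxS⟩ := hloc x
  exact ⟨S, hS.2, ⟨hSj⟩, hxS⟩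
end
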